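/- Under the Gaussian box-decomposition setup, for all m ≠ m', the conditional covariance (1/W)·∫ (y m)(y m')·1_{f ∈ D} dP − ((1/W)·∫ (y m)·1_{f ∈ D} dP)·((1/W)·∫ (y m')·1_{f ∈ D} dP) equals (√(s m)·√(s m')/W) · Σ_{j=1}^J W[j] · (G[j,m]/W[j,m]) · ( G[j,m']/W[j,m'] − (1/W)·Σ_{j'=1}^J W[j']·G[j',m']/W[j',m'] ). -/

import Mathlib

open MeasureTheory ProbabilityTheory

noncomputable section

/-- The density of the standard normal distribution. -/
def stdPdf (z : ℝ) : ℝ := (Real.sqrt (2 * Real.pi))⁻¹ * Real.exp (-z ^ 2 / 2)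

/-- The cumulative distribution function of the standard normal distribution. -/
def stdCdf (x : ℝ) : ℝ := ∫ z in Set.Iic x, stdPdf z

/-- The standardization map `γ m c = (c − μ m)/√(s m)`. -/
def gam {M : ℕ} (μ s : Fin M → ℝ) (m : Fin M) (c : ℝ) : ℝ :=
  (c - μ m) / Real.sqrt (s m)

/-- `W[j,m] = Φ(γ m (u j m)) − Φ(γ m (l j m))`. -/
def Wjm {M J : ℕ} (μ s : Fin M → ℝ) (l u : Fin J → Fin M → ℝ) (j : Fin J) (m : Fin M) : ℝ :=
  stdCdf (gam μ s m (u j m)) - stdCdf (gam μ s m (l j m))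

/-- `W[j] = ∏_m W[j,m]`. -/
def Wj {M J : ℕ} (μ s : Fin M → ℝ) (l u : Fin J → Fin M → ℝ) (j : Fin J) : ℝ :=
  ∏ m, Wjm μ s l u j m

/-- `W = Σ_j W[j]`. -/
def Wtot {M J : ℕ} (μ s : Fin M → ℝ) (l u : Fin J → Fin M → ℝ) : ℝ :=
  ∑ j, Wj μ s l u j

/-- `G[j,m] = φ(γ m (u j m)) − φ(γ m (l j m))`. -/
def Gjm {M J : ℕ} (μ s : Fin M → ℝ) (l u : Fin J → Fin M → ℝ) (j : Fin J) (m : Fin M) : ℝ :=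
  stdPdf (gam μ s m (u j m)) - stdPdf (gam μ s m (l j m))

/-- `V[j,m] = γ m (u j m)·φ(γ m (u j m)) − γ m (l j m)·φ(γ m (l j m))`. -/
def Vjm {M J : ℕ} (μ s : Fin M → ℝ) (l u : Fin J → Fin M → ℝ) (j : Fin J) (m : Fin M) : ℝ :=
  gam μ s m (u j m) * stdPdf (gam μ s m (u j m))
    - gam μ s m (l j m) * stdPdf (gam μ s m (l j m))

/-- `ρ m = √(s m / (s m + σ m))`. -/
def rho {M : ℕ} (s σ : Fin M → ℝ) (m : Fin M) : ℝ := Real.sqrt (s m / (s m + σ m))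

/-- The union `D = ⋃_j B j` of the boxes `B j`. -/
def boxD {M J : ℕ} (l u : Fin J → Fin M → ℝ) : Set (Fin M → ℝ) :=
  ⋃ j, {z : Fin M → ℝ | ∀ m, l j m < z m ∧ z m ≤ u j m}

/-- The joint law of `(f, ε)`: the product of the two product Gaussian measures
`⨂_m N(μ m, s m)` and `⨂_m N(0, σ m)`. -/
def Pmeas {M : ℕ} (μ s σ : Fin M → ℝ) : Measure ((Fin M → ℝ) × (Fin M → ℝ)) :=
  (Measure.pi fun m => gaussianReal (μ m) (s m).toNNReal).prod
    (Measure.pi fun m => gaussianReal 0 (σ m).toNNReal)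

end

section StandardNormal

lemma stdPdf_eq_gaussianPDFReal : stdPdf = gaussianPDFReal 0 1 := by
  ext z
  simp [stdPdf, gaussianPDFReal]

lemma stdPdf_pos (z : ℝ) : 0 < stdPdf z := by
  rw [stdPdf_eq_gaussianPDFReal]
  exact gaussianPDFReal_pos 0 1 z one_ne_zero

lemma continuous_stdPdf : Continuous stdPdf := by
  unfold stdPdf
  fun_prop

lemma hasDerivAt_stdPdf (z : ℝ) : HasDerivAt stdPdf (-(z * stdPdf z)) z := by
  unfold stdPdf
  refine ((((hasDerivAt_id z).pow 2).neg.div_const 2).exp.const_mul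
    (Real.sqrt (2 * Real.pi))⁻¹).congr_deriv ?_
  simp
  ring

lemma integral_stdPdf (a b : ℝ) : ∫ z in a..b, stdPdf z = stdCdf b - stdCdf a := by
  have h : Integrable stdPdf := by
    rw [stdPdf_eq_gaussianPDFReal]
    exact integrable_gaussianPDFReal 0 1
  exact (intervalIntegral.integral_Iic_sub_Iic h.integrableOn h.integrableOn).symm

lemma integral_mul_stdPdf (a b : ℝ) :
    ∫ z in a..b, z * stdPdf z = -(stdPdf b - stdPdf a) := by
  have h := intervalIntegral.integral_eq_sub_of_hasDerivAt (a := a) (b := b)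
    (fun z _ => hasDerivAt_stdPdf z)
    ((continuous_id.mul continuous_stdPdf).neg.intervalIntegrable a b)
  rw [← h, intervalIntegral.integral_neg, neg_neg]

lemma stdCdf_strictMono : StrictMono stdCdf := by
  intro a b hab
  have h := intervalIntegral.intervalIntegral_pos_of_pos
    (continuous_stdPdf.intervalIntegrable a b) stdPdf_pos hab
  rw [integral_stdPdf] at h
  linarith

lemma setIntegral_gaussianReal_zero_one {a b : ℝ} (hab : a ≤ b) (g : ℝ → ℝ) :
    ∫ z in Set.Ioc a b, g z ∂(gaussianReal 0 1) = ∫ z in a..b, stdPdf z * g z := by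
  rw [← integral_indicator measurableSet_Ioc,
    integral_gaussianReal_eq_integral_smul one_ne_zero, intervalIntegral.integral_of_le hab,
    ← integral_indicator measurableSet_Ioc, stdPdf_eq_gaussianPDFReal]
  congr 1
  ext z
  by_cases hz : z ∈ Set.Ioc a b <;> simp [hz]

end StandardNormal

section Gaussian

lemma gaussianReal_eq_map_affine (μ : ℝ) {s : ℝ} (hs : 0 < s) :
    gaussianReal μ s.toNNReal = (gaussianReal 0 1).map (fun z => Real.sqrt s * z + μ) := by
  have h : (fun z => Real.sqrt s * z + μ) = (fun x => x + μ) ∘ (fun z => Real.sqrt s * z) := rfl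
  rw [h, ← Measure.map_map (by fun_prop) (by fun_prop), gaussianReal_map_const_mul,
    gaussianReal_map_add_const]
  congr 1
  · simp
  · ext
    simp [hs.le]

lemma setIntegral_gaussianReal {μ s a b : ℝ} (hs : 0 < s) (hab : a ≤ b) (g : ℝ → ℝ)
    (hg : Measurable g) :
    ∫ x in Set.Ioc a b, g x ∂(gaussianReal μ s.toNNReal)
      = ∫ z in ((a - μ) / Real.sqrt s)..((b - μ) / Real.sqrt s),
          stdPdf z * g (Real.sqrt s * z + μ) := by
  have hr : 0 < Real.sqrt s := Real.sqrt_pos.mpr hs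
  rw [gaussianReal_eq_map_affine μ hs, setIntegral_map measurableSet_Ioc
    hg.aestronglyMeasurable (by fun_prop), ← setIntegral_gaussianReal_zero_one (by gcongr)]
  congr 2
  ext z
  simp only [Set.mem_preimage, Set.mem_Ioc, div_lt_iff₀ hr, le_div_iff₀ hr]
  constructor <;> rintro ⟨h1, h2⟩ <;> constructor <;> linarith

lemma setIntegral_one_gaussianReal {μ s a b : ℝ} (hs : 0 < s) (hab : a ≤ b) :
    ∫ _ in Set.Ioc a b, (1 : ℝ) ∂(gaussianReal μ s.toNNReal)
      = stdCdf ((b - μ) / Real.sqrt s) - stdCdf ((a - μ) / Real.sqrt s) := by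
  rw [setIntegral_gaussianReal hs hab _ measurable_const]
  simp only [mul_one, integral_stdPdf]

lemma setIntegral_id_gaussianReal {μ s a b : ℝ} (hs : 0 < s) (hab : a ≤ b) :
    ∫ x in Set.Ioc a b, x ∂(gaussianReal μ s.toNNReal)
      = μ * (stdCdf ((b - μ) / Real.sqrt s) - stdCdf ((a - μ) / Real.sqrt s))
        - Real.sqrt s * (stdPdf ((b - μ) / Real.sqrt s) - stdPdf ((a - μ) / Real.sqrt s)) := by
  rw [setIntegral_gaussianReal hs hab (fun x => x) measurable_id]
  have h (z : ℝ) : stdPdf z * (Real.sqrt s * z + μ)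
      = Real.sqrt s * (z * stdPdf z) + μ * stdPdf z := by ring
  have hcont := continuous_stdPdf
  simp only [h]
  rw [intervalIntegral.integral_add (Continuous.intervalIntegrable (by fun_prop) _ _)
    (Continuous.intervalIntegrable (by fun_prop) _ _),
    intervalIntegral.integral_const_mul, intervalIntegral.integral_const_mul,
    integral_stdPdf, integral_mul_stdPdf]
  ring

lemma integrable_id_gaussianReal (μ : ℝ) (v : NNReal) :
    Integrable (fun x : ℝ => x) (gaussianReal μ v) :=
  memLp_one_iff_integrable.mp (memLp_id_gaussianReal 1)

end Gaussian

section NoisyObservation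

variable {μ s σ a b : ℝ}

lemma integrable_indicator_fst_mul_add :
    Integrable (fun q : ℝ × ℝ => (Set.Ioc a b).indicator (fun _ => (1 : ℝ)) q.1 * (q.1 + q.2))
      ((gaussianReal μ s.toNNReal).prod (gaussianReal 0 σ.toNNReal)) := by
  have h := (((integrable_id_gaussianReal μ s.toNNReal).comp_fst
    (gaussianReal 0 σ.toNNReal)).add ((integrable_id_gaussianReal 0 σ.toNNReal).comp_snd
    (gaussianReal μ s.toNNReal))).indicator (measurable_fst (measurableSet_Ioc (a := a) (b := b)))
  refine h.congr (ae_of_all _ fun q => ?_)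
  by_cases hq : q.1 ∈ Set.Ioc a b <;> simp [Set.indicator, hq]

lemma integrable_indicator_Ioc (ν : Measure ℝ) [IsFiniteMeasure ν] :
    Integrable ((Set.Ioc a b).indicator fun _ => (1 : ℝ)) ν :=
  (integrable_const 1).indicator measurableSet_Ioc

lemma integral_indicator_fst (hs : 0 < s) (hab : a ≤ b) :
    ∫ q : ℝ × ℝ, (Set.Ioc a b).indicator (fun _ => (1 : ℝ)) q.1
        ∂((gaussianReal μ s.toNNReal).prod (gaussianReal 0 σ.toNNReal))
      = stdCdf ((b - μ) / Real.sqrt s) - stdCdf ((a - μ) / Real.sqrt s) := by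
  rw [integral_fun_fst, integral_indicator measurableSet_Ioc, setIntegral_one_gaussianReal hs hab]
  simp

lemma integral_indicator_fst_mul_add (hs : 0 < s) (hab : a ≤ b) :
    ∫ q : ℝ × ℝ, (Set.Ioc a b).indicator (fun _ => (1 : ℝ)) q.1 * (q.1 + q.2)
        ∂((gaussianReal μ s.toNNReal).prod (gaussianReal 0 σ.toNNReal))
      = μ * (stdCdf ((b - μ) / Real.sqrt s) - stdCdf ((a - μ) / Real.sqrt s))
        - Real.sqrt s * (stdPdf ((b - μ) / Real.sqrt s) - stdPdf ((a - μ) / Real.sqrt s)) := by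
  have h (q : ℝ × ℝ) : (Set.Ioc a b).indicator (fun _ => (1 : ℝ)) q.1 * (q.1 + q.2)
      = (Set.Ioc a b).indicator (fun x => x) q.1
        + (Set.Ioc a b).indicator (fun _ => (1 : ℝ)) q.1 * q.2 := by
    by_cases hq : q.1 ∈ Set.Ioc a b <;> simp [Set.indicator, hq]
  simp_rw [h]
  rw [integral_add
    (((integrable_id_gaussianReal _ _).indicator measurableSet_Ioc).comp_fst _)
    ((integrable_indicator_Ioc _).mul_prod (integrable_id_gaussianReal _ _)),
    integral_prod_mul ((Set.Ioc a b).indicator fun _ => (1 : ℝ)) (fun y => y),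
    integral_id_gaussianReal, mul_zero, add_zero, integral_fun_fst,
    integral_indicator measurableSet_Ioc, setIntegral_id_gaussianReal hs hab]
  simp

end NoisyObservation

section Boxes

variable {M J : ℕ} {μ s σ : Fin M → ℝ} {l u : Fin J → Fin M → ℝ}

lemma Wjm_pos (hs : ∀ m, 0 < s m) (hlu : ∀ j m, l j m < u j m) (j : Fin J) (m : Fin M) :
    0 < Wjm μ s l u j m := by
  refine sub_pos.mpr (stdCdf_strictMono ?_)
  exact div_lt_div_of_pos_right (sub_lt_sub_right (hlu j m) _) (Real.sqrt_pos.mpr (hs m))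

lemma Wtot_pos (hJ : 1 ≤ J) (hs : ∀ m, 0 < s m) (hlu : ∀ j m, l j m < u j m) :
    0 < Wtot μ s l u :=
  Finset.sum_pos (fun j _ => Finset.prod_pos fun m _ => Wjm_pos hs hlu j m)
    ⟨⟨0, hJ⟩, Finset.mem_univ _⟩

lemma indicator_boxD_eq_sum_prod
    (hdisj : Pairwise fun j j' : Fin J => Disjoint
        {z : Fin M → ℝ | ∀ m, l j m < z m ∧ z m ≤ u j m}
        {z : Fin M → ℝ | ∀ m, l j' m < z m ∧ z m ≤ u j' m})
    (z : Fin M → ℝ) :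
    (boxD l u).indicator (fun _ => (1 : ℝ)) z
      = ∑ j, ∏ m, (Set.Ioc (l j m) (u j m)).indicator (fun _ => (1 : ℝ)) (z m) := by
  have hbox (j : Fin J) : ∏ m, (Set.Ioc (l j m) (u j m)).indicator (fun _ => (1 : ℝ)) (z m)
      = {z : Fin M → ℝ | ∀ m, l j m < z m ∧ z m ≤ u j m}.indicator (fun _ => (1 : ℝ)) z := by
    simp only [Set.indicator_apply, Set.mem_Ioc, Set.mem_ofPred_eq]
    rw [Finset.prod_ite_zero]
    simp
  simp_rw [hbox]
  by_cases hz : z ∈ boxD l u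
  · obtain ⟨j, hj⟩ := Set.mem_iUnion.mp hz
    rw [Finset.sum_eq_single j, Set.indicator_of_mem hz, Set.indicator_of_mem hj]
    · exact fun j' _ hne => Set.indicator_of_notMem
        (fun hj' => Set.disjoint_left.mp (hdisj hne) hj' hj) _
    · simp
  · rw [Set.indicator_of_notMem hz]
    refine (Finset.sum_eq_zero fun j _ => Set.indicator_of_notMem (fun hj => hz ?_) _).symm
    exact Set.mem_iUnion.mpr ⟨j, hj⟩

/-- The mixed moment, over the event `f ∈ D`, of the observations with index in `S`. -/
lemma integral_prod_observations_indicator_boxD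
    (hs : ∀ m, 0 < s m) (hlu : ∀ j m, l j m < u j m)
    (hdisj : Pairwise fun j j' : Fin J => Disjoint
        {z : Fin M → ℝ | ∀ m, l j m < z m ∧ z m ≤ u j m}
        {z : Fin M → ℝ | ∀ m, l j' m < z m ∧ z m ≤ u j' m})
    (S : Finset (Fin M)) :
    ∫ p, (∏ m ∈ S, (p.1 m + p.2 m)) * (boxD l u).indicator (fun _ => (1 : ℝ)) p.1
        ∂(Pmeas μ s σ)
      = ∑ j, Wj μ s l u j
          * ∏ m ∈ S, (μ m - Real.sqrt (s m) * (Gjm μ s l u j m / Wjm μ s l u j m)) := by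
  let h (j : Fin J) (m : Fin M) (q : ℝ × ℝ) : ℝ :=
    (Set.Ioc (l j m) (u j m)).indicator (fun _ => (1 : ℝ)) q.1 * if m ∈ S then q.1 + q.2 else 1
  have hint (j : Fin J) (m : Fin M) : Integrable (h j m)
      ((gaussianReal (μ m) (s m).toNNReal).prod (gaussianReal 0 (σ m).toNNReal)) := by
    by_cases hm : m ∈ S
    · simpa only [h, hm, if_true] using integrable_indicator_fst_mul_add
    · simpa only [h, hm, if_false, mul_one] using (integrable_indicator_Ioc _).comp_fst _
  have hval (j : Fin J) (m : Fin M) : ∫ q, h j m q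
      ∂((gaussianReal (μ m) (s m).toNNReal).prod (gaussianReal 0 (σ m).toNNReal))
      = Wjm μ s l u j m * if m ∈ S then
          μ m - Real.sqrt (s m) * (Gjm μ s l u j m / Wjm μ s l u j m) else 1 := by
    by_cases hm : m ∈ S
    · have hW : Wjm μ s l u j m ≠ 0 := (Wjm_pos hs hlu j m).ne'
      simp only [h, hm, if_true]
      rw [integral_indicator_fst_mul_add (hs m) (hlu j m).le]
      change μ m * Wjm μ s l u j m - Real.sqrt (s m) * Gjm μ s l u j m = _
      field_simp
    · simp only [h, hm, if_false, mul_one]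
      exact integral_indicator_fst (hs m) (hlu j m).le
  rw [Pmeas, ← (measurePreserving_arrowProdEquivProdArrow ℝ ℝ (Fin M)
    (fun m => gaussianReal (μ m) (s m).toNNReal)
    (fun m => gaussianReal 0 (σ m).toNNReal)).integral_comp']
  have hsplit (x : Fin M → ℝ × ℝ) :
      (∏ m ∈ S, ((x m).1 + (x m).2))
        * (boxD l u).indicator (fun _ => (1 : ℝ)) (fun m => (x m).1)
      = ∑ j, ∏ m, h j m (x m) := by
    rw [indicator_boxD_eq_sum_prod hdisj, Finset.mul_sum]
    simp only [h, Finset.prod_mul_distrib, Finset.prod_ite_mem, Finset.univ_inter]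
    exact Finset.sum_congr rfl fun j _ => mul_comm _ _
  refine (integral_congr_ae (ae_of_all _ hsplit)).trans ?_
  rw [integral_finsetSum _ fun j _ => Integrable.fintype_prod (hint j)]
  refine Finset.sum_congr rfl fun j _ => ?_
  rw [integral_fintype_prod_eq_prod (h j)]
  simp only [hval, Finset.prod_mul_distrib, Finset.prod_ite_mem, Finset.univ_inter, Wj]

end Boxes

/-- Conditional covariance formula for `m ≠ m'`. -/
theorem conditional_covariance
    (M J : ℕ) (hM : 1 ≤ M) (hJ : 1 ≤ J)
    (μ s σ : Fin M → ℝ) (hs : ∀ m, 0 < s m) (hσ : ∀ m, 0 ≤ σ m)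
    (l u : Fin J → Fin M → ℝ) (hlu : ∀ j m, l j m < u j m)
    (hdisj : Pairwise fun j j' : Fin J => Disjoint
        {z : Fin M → ℝ | ∀ m, l j m < z m ∧ z m ≤ u j m}
        {z : Fin M → ℝ | ∀ m, l j' m < z m ∧ z m ≤ u j' m})
    (m m' : Fin M) (hmm' : m ≠ m') :
    (1 / Wtot μ s l u) * (∫ p, (p.1 m + p.2 m) * (p.1 m' + p.2 m')
          * Set.indicator (boxD l u) (fun _ => (1 : ℝ)) p.1 ∂(Pmeas μ s σ))
      - ((1 / Wtot μ s l u) * ∫ p, (p.1 m + p.2 m)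
            * Set.indicator (boxD l u) (fun _ => (1 : ℝ)) p.1 ∂(Pmeas μ s σ))
        * ((1 / Wtot μ s l u) * ∫ p, (p.1 m' + p.2 m')
            * Set.indicator (boxD l u) (fun _ => (1 : ℝ)) p.1 ∂(Pmeas μ s σ))
      = (Real.sqrt (s m) * Real.sqrt (s m') / Wtot μ s l u)
          * ∑ j, Wj μ s l u j * (Gjm μ s l u j m / Wjm μ s l u j m)
            * (Gjm μ s l u j m' / Wjm μ s l u j m'
                - (1 / Wtot μ s l u)
                  * ∑ j', Wj μ s l u j' * (Gjm μ s l u j' m' / Wjm μ s l u j' m')) := by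
  have hW : Wtot μ s l u ≠ 0 := (Wtot_pos hJ hs hlu).ne'
  have hpair := integral_prod_observations_indicator_boxD (μ := μ) (σ := σ) hs hlu hdisj {m, m'}
  have hone (i : Fin M) :=
    integral_prod_observations_indicator_boxD (μ := μ) (σ := σ) hs hlu hdisj {i}
  simp only [Finset.prod_pair hmm'] at hpair
  simp only [Finset.prod_singleton] at hone
  rw [hpair, hone m, hone m']
  set w : Fin J → ℝ := Wj μ s l u
  set g : Fin J → Fin M → ℝ := fun j i => Gjm μ s l u j i / Wjm μ s l u j i
  have hgw (j : Fin J) (i : Fin M) : Gjm μ s l u j i / Wjm μ s l u j i = g j i := rfl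
  have hsum : Wtot μ s l u = ∑ j, w j := rfl
  simp only [hgw]
  have hmean (i : Fin M) : ∑ j, w j * (μ i - Real.sqrt (s i) * g j i)
      = μ i * Wtot μ s l u - Real.sqrt (s i) * ∑ j, w j * g j i := by
    rw [hsum, Finset.mul_sum, Finset.mul_sum, ← Finset.sum_sub_distrib]
    exact Finset.sum_congr rfl fun j _ => by ring
  have hmixed : ∑ j, w j * ((μ m - Real.sqrt (s m) * g j m) * (μ m' - Real.sqrt (s m') * g j m'))
      = μ m * μ m' * Wtot μ s l u - μ m * Real.sqrt (s m') * ∑ j, w j * g j m'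
        - μ m' * Real.sqrt (s m) * ∑ j, w j * g j m
        + Real.sqrt (s m) * Real.sqrt (s m') * ∑ j, w j * g j m * g j m' := by
    rw [hsum]
    simp only [Finset.mul_sum]
    rw [← Finset.sum_sub_distrib, ← Finset.sum_sub_distrib, ← Finset.sum_add_distrib]
    exact Finset.sum_congr rfl fun j _ => by ring
  have hcentred (c : ℝ) : ∑ j, w j * g j m * (g j m' - c)
      = ∑ j, w j * g j m * g j m' - (∑ j, w j * g j m) * c := by
    rw [Finset.sum_mul, ← Finset.sum_sub_distrib]
    exact Finset.sum_congr rfl fun j _ => by ring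
  rw [hmean, hmean, hmixed, hcentred]
  field_simp
  ring
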